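/- arXiv:1007.5447 — 2 statements merged into one kernel-verified Lean document; each statement's English description precedes it below -/
import Mathlib

section
/- Let 1 ≤ M ≤ N be integers, λ > 0, and τ > 0. Then (1/τ) · ∫_{0}^{τ} (1 − ∑_{k=M}^{N} C(N,k) · e^{−kλt} · (1 − e^{−λt})^{N−k}) dt = 1 − ∑_{x=M}^{N} S(M,N,x) · (1 − e^{−xλτ}) / (xλτ). -/
/-- The coefficient `S(M,N,x) = ∑_{k=M}^{x} C(N,x) · C(x,k) · (−1)^{x−k}`. -/
noncomputable def S (M N x : ℕ) : ℝ :=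
  ∑ k ∈ Finset.Icc M x, (N.choose x : ℝ) * (x.choose k : ℝ) * (-1 : ℝ) ^ (x - k)

theorem choose_mul_pow_mul_one_sub_pow {R : Type*} [CommRing R] {k N : ℕ} (hkN : k ≤ N) (y : R) :
    (N.choose k : R) * y ^ k * (1 - y) ^ (N - k) =
      ∑ x ∈ Finset.Icc k N, (N.choose x : R) * (x.choose k : R) * (-1) ^ (x - k) * y ^ x := by
  rw [← Finset.Ico_add_one_right_eq_Icc, Finset.sum_Ico_eq_sum_range, sub_eq_neg_add, add_pow,
    Finset.mul_sum, Nat.sub_add_comm hkN]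
  refine Finset.sum_congr rfl fun m _ => ?_
  have h : (N.choose (k + m) : R) * ((k + m).choose k : R) =
      (N.choose k : R) * ((N - k).choose m : R) := by
    have := Nat.choose_mul (n := N) (Nat.le_add_right k m)
    rw [Nat.add_sub_cancel_left] at this
    simpa using congrArg (Nat.cast : ℕ → R) this
  rw [h, Nat.add_sub_cancel_left, neg_pow y, one_pow, pow_add]
  ring

theorem sum_choose_mul_pow_mul_one_sub_pow_eq_sum_S (M N : ℕ) (y : ℝ) :
    ∑ k ∈ Finset.Icc M N, (N.choose k : ℝ) * y ^ k * (1 - y) ^ (N - k) =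
      ∑ x ∈ Finset.Icc M N, S M N x * y ^ x := by
  rw [Finset.sum_congr rfl fun k hk =>
    choose_mul_pow_mul_one_sub_pow (Finset.mem_Icc.1 hk).2 y]
  simp only [S, Finset.sum_mul]
  refine Finset.sum_comm' fun k x => ?_
  simp only [Finset.mem_Icc]
  omega

theorem integral_exp_neg_mul {c : ℝ} (hc : c ≠ 0) (τ : ℝ) :
    ∫ t in (0 : ℝ)..τ, Real.exp (-(c * t)) = (1 - Real.exp (-(c * τ))) / c := by
  simp_rw [← neg_mul]
  rw [intervalIntegral.integral_comp_mul_left _ (neg_ne_zero.2 hc), integral_exp, smul_eq_mul,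
    mul_zero, Real.exp_zero]
  field_simp
  ring

theorem stmt_8 (M N : ℕ) (hM : 1 ≤ M) (hMN : M ≤ N)
    (lam τ : ℝ) (hlam : 0 < lam) (hτ : 0 < τ) :
    (1 / τ) *
        ∫ t in (0 : ℝ)..τ,
          (1 - ∑ k ∈ Finset.Icc M N,
            (N.choose k : ℝ) * Real.exp (-((k : ℝ) * lam * t)) *
              (1 - Real.exp (-(lam * t))) ^ (N - k))
      = 1 - ∑ x ∈ Finset.Icc M N,
          S M N x * (1 - Real.exp (-((x : ℝ) * lam * τ))) / ((x : ℝ) * lam * τ) := by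
  have hexp (k : ℕ) (t : ℝ) :
      Real.exp (-((k : ℝ) * lam * t)) = Real.exp (-(lam * t)) ^ k := by
    rw [← Real.exp_nat_mul]
    ring_nf
  have hint (t : ℝ) :
      1 - ∑ k ∈ Finset.Icc M N, (N.choose k : ℝ) * Real.exp (-((k : ℝ) * lam * t)) *
          (1 - Real.exp (-(lam * t))) ^ (N - k) =
        1 - ∑ x ∈ Finset.Icc M N, S M N x * Real.exp (-((x : ℝ) * lam * t)) := by
    simp only [hexp, sum_choose_mul_pow_mul_one_sub_pow_eq_sum_S]
  simp only [hint]
  rw [intervalIntegral.integral_sub (by simp)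
      (Continuous.intervalIntegrable (by fun_prop) _ _),
    intervalIntegral.integral_finsetSum
      fun x _ => Continuous.intervalIntegrable (by fun_prop) _ _,
    intervalIntegral.integral_const, smul_eq_mul, sub_zero, mul_one, mul_sub,
    one_div_mul_cancel hτ.ne', Finset.mul_sum]
  congr 1
  refine Finset.sum_congr rfl fun x hx => ?_
  have hx0 : (x : ℝ) ≠ 0 := by
    have := (Finset.mem_Icc.1 hx).1
    exact_mod_cast (by omega : x ≠ 0)
  rw [intervalIntegral.integral_const_mul, integral_exp_neg_mul (mul_ne_zero hx0 hlam.ne')]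
  field_simp
end

section
/- Let 1 ≤ M ≤ N be integers and τ > 0 fixed. For λ > 0 define PFDs(λ) = 1 − ∑_{x=M}^{N} S(M,N,x) · (1 − e^{−xλτ}) / (xλτ). Then, as λ → 0⁺, PFDs(λ) / λ^{N−M+1} tends to C(N, M−1) · τ^{N−M+1} / (N−M+2). -/
open Filter Topology Finset

/-- The coefficients `S M N x` expand the upper binomial tail in powers of `p`. -/
theorem sum_S_mul_pow (M N : ℕ) (p : ℝ) :
    ∑ x ∈ Icc M N, S M N x * p ^ x =
      ∑ k ∈ Icc M N, (N.choose k : ℝ) * p ^ k * (1 - p) ^ (N - k) := by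
  simp only [S, sum_mul]
  rw [sum_comm' (t' := Icc M N) (s' := fun k => Ico k (N + 1))
    (fun x k => by simp only [mem_Icc, mem_Ico]; omega)]
  refine sum_congr rfl fun k hk => ?_
  rw [mem_Icc] at hk
  rw [sum_Ico_eq_sum_range, show N + 1 - k = N - k + 1 by omega,
    show 1 - p = -p + 1 by ring, add_pow, mul_sum]
  refine sum_congr rfl fun j _ => ?_
  have h : (N.choose (k + j) : ℝ) * ((k + j).choose k : ℝ) =
      (N.choose k : ℝ) * ((N - k).choose j : ℝ) := by
    have := Nat.choose_mul (n := N) (Nat.le_add_right k j)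
    rw [Nat.add_sub_cancel_left] at this
    exact_mod_cast this
  rw [h, Nat.add_sub_cancel_left, pow_add, neg_pow p j, one_pow]
  ring

/-- The complementary form of `sum_S_mul_pow`: the lower binomial tail. -/
theorem one_sub_sum_S_mul_pow {M N : ℕ} (hMN : M ≤ N) (p : ℝ) :
    1 - ∑ x ∈ Icc M N, S M N x * p ^ x =
      ∑ k ∈ range M, (N.choose k : ℝ) * p ^ k * (1 - p) ^ (N - k) := by
  have htotal : ∑ k ∈ range (N + 1), (N.choose k : ℝ) * p ^ k * (1 - p) ^ (N - k) = 1 := by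
    calc _ = (p + (1 - p)) ^ N := by
          rw [add_pow]
          exact sum_congr rfl fun k _ => by rw [mul_assoc, mul_comm]
      _ = 1 := by rw [add_sub_cancel, one_pow]
  have hIcc : Icc M N = Ico M (N + 1) := by ext; simp
  rw [sum_S_mul_pow, hIcc, sub_eq_iff_eq_add,
    sum_range_add_sum_Ico _ (by omega : M ≤ N + 1), htotal]

theorem tendsto_one_sub_exp_neg_div :
    Tendsto (fun u : ℝ => (1 - Real.exp (-u)) / u) (𝓝[>] 0) (𝓝 1) := by
  have h : HasDerivAt (fun u : ℝ => 1 - Real.exp (-u)) 1 0 := by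
    simpa using ((hasDerivAt_neg (0 : ℝ)).exp).const_sub 1
  refine h.tendsto_slope_zero_right.congr fun u => ?_
  simp [div_eq_inv_mul]

/-- The lower binomial tail at `p = exp (-u)` has order exactly `N - M + 1` at `u = 0`. -/
theorem tendsto_one_sub_sum_S_exp_div {M N : ℕ} (hM : 1 ≤ M) (hMN : M ≤ N) :
    Tendsto (fun u : ℝ => (1 - ∑ x ∈ Icc M N, S M N x * Real.exp (-u) ^ x) / u ^ (N - M + 1))
      (𝓝[>] 0) (𝓝 (N.choose (M - 1) : ℝ)) := by
  have hexp : Tendsto (fun u : ℝ => Real.exp (-u)) (𝓝[>] 0) (𝓝 1) :=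
    ((by fun_prop : Continuous fun u : ℝ => Real.exp (-u)).tendsto' 0 1 (by simp)).mono_left
      nhdsWithin_le_nhds
  have hterm : ∀ k ∈ range M, Tendsto
      (fun u : ℝ => (N.choose k : ℝ) * Real.exp (-u) ^ k *
        (((1 - Real.exp (-u)) / u) ^ (N - M + 1) * (1 - Real.exp (-u)) ^ (M - 1 - k)))
      (𝓝[>] 0) (𝓝 ((N.choose k : ℝ) * 1 ^ k * (1 ^ (N - M + 1) * (1 - 1) ^ (M - 1 - k)))) :=
    fun k _ => ((hexp.pow k).const_mul _).mul
      ((tendsto_one_sub_exp_neg_div.pow _).mul ((hexp.const_sub 1).pow _))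
  have hlim : ∑ k ∈ range M,
      ((N.choose k : ℝ) * 1 ^ k * (1 ^ (N - M + 1) * (1 - 1) ^ (M - 1 - k))) =
      (N.choose (M - 1) : ℝ) := by
    rw [sum_eq_single_of_mem (M - 1) (by simp; omega)]
    · simp
    · intro k hk hne
      rw [mem_range] at hk
      rw [sub_self, zero_pow (by omega)]
      ring
  rw [← hlim]
  refine (tendsto_finsetSum _ hterm).congr fun u => ?_
  rw [one_sub_sum_S_mul_pow hMN, sum_div]
  refine sum_congr rfl fun k hk => ?_
  rw [mem_range] at hk
  rw [show N - k = (N - M + 1) + (M - 1 - k) by omega, pow_add, div_pow]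
  ring

/-- The integrated lower binomial tail, normalised by its leading power of `u`. -/
theorem tendsto_sub_sum_S_div {M N : ℕ} (hM : 1 ≤ M) (hMN : M ≤ N) :
    Tendsto
      (fun u : ℝ => (u - ∑ x ∈ Icc M N, S M N x * ((1 - Real.exp (-(x * u))) / x)) /
        u ^ (N - M + 2))
      (𝓝[>] 0) (𝓝 ((N.choose (M - 1) : ℝ) / ((N : ℝ) - M + 2))) := by
  have hcast : ((N - M + 2 : ℕ) : ℝ) = (N : ℝ) - M + 2 := by push_cast [Nat.cast_sub hMN]; rfl
  have hderiv : ∀ u : ℝ, HasDerivAt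
      (fun u : ℝ => u - ∑ x ∈ Icc M N, S M N x * ((1 - Real.exp (-(x * u))) / x))
      (1 - ∑ x ∈ Icc M N, S M N x * Real.exp (-u) ^ x) u := by
    intro u
    refine (hasDerivAt_id' u).sub (HasDerivAt.fun_sum fun x hx => HasDerivAt.const_mul _ ?_)
    have hx0 : (x : ℝ) ≠ 0 := by
      rw [mem_Icc] at hx
      exact_mod_cast (by omega : x ≠ 0)
    refine ((((hasDerivAt_id' u).const_mul (x : ℝ)).neg.exp.const_sub 1).div_const
      (x : ℝ)).congr_deriv ?_
    rw [← Real.exp_nat_mul, mul_neg]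
    simp only [Pi.neg_apply]
    field_simp
  refine HasDerivAt.lhopital_zero_nhdsGT (Eventually.of_forall hderiv)
    (Eventually.of_forall fun u => hasDerivAt_pow (N - M + 2) u) ?_ ?_ ?_ ?_
  · filter_upwards [self_mem_nhdsWithin] with u (hu : 0 < u)
    positivity
  · have h := (hderiv 0).continuousAt.tendsto.mono_left (nhdsWithin_le_nhds (s := Set.Ioi 0))
    simpa using h
  · exact ((continuous_pow (N - M + 2)).tendsto' 0 0 (by simp)).mono_left nhdsWithin_le_nhds
  · rw [← hcast]
    refine ((tendsto_one_sub_sum_S_exp_div hM hMN).div_const _).congr fun u => ?_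
    rw [div_div, mul_comm]
    rfl

theorem stmt_12 (M N : ℕ) (hM : 1 ≤ M) (hMN : M ≤ N) (τ : ℝ) (hτ : 0 < τ) :
    Filter.Tendsto
      (fun lam : ℝ =>
        (1 - ∑ x ∈ Finset.Icc M N,
          S M N x * (1 - Real.exp (-((x : ℝ) * lam * τ))) / ((x : ℝ) * lam * τ))
          / lam ^ (N - M + 1))
      (nhdsWithin 0 (Set.Ioi 0))
      (nhds ((N.choose (M - 1) : ℝ) * τ ^ (N - M + 1) / ((N : ℝ) - M + 2))) := by
  have hscale : Tendsto (fun lam : ℝ => lam * τ) (𝓝[>] 0) (𝓝[>] 0) := by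
    refine tendsto_nhdsWithin_iff.2 ⟨?_, ?_⟩
    · exact ((continuous_mul_const τ).tendsto' 0 0 (by simp)).mono_left nhdsWithin_le_nhds
    · filter_upwards [self_mem_nhdsWithin] with lam hlam
      exact mul_pos hlam hτ
  have h := ((tendsto_sub_sum_S_div hM hMN).comp hscale).mul_const (τ ^ (N - M + 1))
  rw [div_mul_eq_mul_div] at h
  refine h.congr' ?_
  filter_upwards [self_mem_nhdsWithin] with lam (hlam : 0 < lam)
  have hu : lam * τ ≠ 0 := by positivity
  have hsum : ∑ x ∈ Icc M N,
      S M N x * (1 - Real.exp (-((x : ℝ) * lam * τ))) / ((x : ℝ) * lam * τ) =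
      (∑ x ∈ Icc M N, S M N x * ((1 - Real.exp (-(x * (lam * τ)))) / x)) / (lam * τ) := by
    rw [sum_div]
    refine sum_congr rfl fun x _ => ?_
    rw [mul_assoc (x : ℝ), ← mul_div_assoc, div_div]
  rw [hsum, Function.comp_apply, show N - M + 2 = (N - M + 1) + 1 from rfl, pow_succ, mul_pow]
  field_simp
end
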